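/- arXiv:1802.05399 — 10 statements merged into one kernel-verified Lean document; each statement's English description precedes it below -/
import Mathlib

section
/- Let T ≥ 1 be an integer, let a_1 < a_2 < … < a_T be a strictly increasing sequence of integers, and let b_1 ≥ b_2 ≥ … ≥ b_T be a non-increasing sequence of real numbers. Then the total absolute loss satisfies Σ_{i=1}^T |a_i − b_i| ≥ (T² − 1)/4. -/
theorem StrictMono.fin_zero_add_le {n : ℕ} {a : Fin (n + 1) → ℤ} (ha : StrictMono a)
    (i : Fin (n + 1)) : a 0 + (i : ℕ) ≤ a i := by
  induction i using Fin.induction with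
  | zero => simp
  | succ i ih =>
    have h := ha (Fin.castSucc_lt_succ (i := i))
    simp only [Fin.val_castSucc, Fin.val_succ] at ih ⊢
    push_cast
    lia

/-- The bound also holds for `T = 0`; the induction removes the first and the last index. -/
theorem sq_sub_one_div_four_le_sum_abs_sub : ∀ (T : ℕ) (a : Fin T → ℤ) (_ : StrictMono a)
    (b : Fin T → ℝ) (_ : Antitone b),
    ((T : ℝ) ^ 2 - 1) / 4 ≤ ∑ i, |(a i : ℝ) - b i|
  | 0, a, _, b, _ => by norm_num
  | 1, a, _, b, _ => by simp
  | T + 2, a, ha, b, hb => by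
    have ih := sq_sub_one_div_four_le_sum_abs_sub T (fun i => a i.castSucc.succ)
      (fun _ _ h => ha (by simpa using h)) (fun i => b i.castSucc.succ)
      (fun _ _ h => hb (by simpa using h))
    have hgap : (a 0 : ℝ) + (T + 1) ≤ a (Fin.last (T + 1)) := by
      exact_mod_cast ha.fin_zero_add_le (Fin.last (T + 1))
    have hb' : b (Fin.last (T + 1)) ≤ b 0 := hb (Fin.zero_le _)
    have h₀ := neg_abs_le ((a 0 : ℝ) - b 0)
    have h₁ := le_abs_self ((a (Fin.last (T + 1)) : ℝ) - b (Fin.last (T + 1)))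
    rw [Fin.sum_univ_succ, Fin.sum_univ_castSucc, Fin.succ_last]
    push_cast
    linarith


/-- For any integer `T ≥ 1`, any strictly increasing sequence of
integers `a : Fin T → ℤ` and any non-increasing sequence of reals `b : Fin T → ℝ`,
the total absolute loss satisfies `∑ i, |a i - b i| ≥ (T² - 1)/4`. -/
theorem absolute_loss_lower_bound (T : ℕ) (hT : 1 ≤ T)
    (a : Fin T → ℤ) (ha : StrictMono a)
    (b : Fin T → ℝ) (hb : Antitone b) :
    ((T : ℝ) ^ 2 - 1) / 4 ≤ ∑ i, |(a i : ℝ) - b i| := by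
  exact sq_sub_one_div_four_le_sum_abs_sub T a ha b hb
end

section
/- Let T ≥ 1 be an integer, let a_1 < a_2 < … < a_T be a strictly increasing sequence of integers, and let b_1 ≥ b_2 ≥ … ≥ b_T be a non-increasing sequence of real numbers. If Σ_{i=1}^T |a_i − b_i| ≤ m for some real m ≥ 0, then T ≤ √(4m + 1). (Equivalently, the spread of the absolute loss satisfies S_{ℓ₁}(m) ≤ √(4m+1).) -/
/-- A strictly increasing integer sequence grows at least as fast as its index. -/
theorem StrictMono.fin_sub_le_int_sub {T : ℕ} {a : Fin T → ℤ} (ha : StrictMono a) {i j : Fin T}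
    (hij : i ≤ j) : (j : ℤ) - i ≤ a j - a i := by
  have hcard : (Finset.Icc i j).card ≤ (Finset.Icc (a i) (a j)).card :=
    Finset.card_le_card_of_injOn a
      (fun k hk => by
        simp only [Finset.coe_Icc, Set.mem_Icc] at hk ⊢
        exact ⟨ha.monotone hk.1, ha.monotone hk.2⟩)
      ha.injective.injOn
  rw [Fin.card_Icc, Int.card_Icc] at hcard
  have hle : (i : ℕ) ≤ j := hij
  have := ha.monotone hij
  omega

/-- The absolute losses at two indices add up to at least the distance between the indices. -/
theorem abs_index_sub_le_abs_add_abs {T : ℕ} {a : Fin T → ℤ} (ha : StrictMono a)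
    {b : Fin T → ℝ} (hb : Antitone b) (i j : Fin T) :
    |(j : ℝ) - i| ≤ |(a i : ℝ) - b i| + |(a j : ℝ) - b j| := by
  wlog hij : i ≤ j generalizing i j
  · rw [abs_sub_comm, add_comm]
    exact this j i (le_of_not_ge hij)
  have hgap : (j : ℝ) - i ≤ a j - a i := by exact_mod_cast ha.fin_sub_le_int_sub hij
  have hle : (i : ℝ) ≤ j := by exact_mod_cast hij
  rw [abs_of_nonneg (sub_nonneg.2 hle)]
  linarith [hb hij, neg_abs_le ((a i : ℝ) - b i), le_abs_self ((a j : ℝ) - b j)]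

theorem sq_sub_one_div_two_le_sum_abs (T : ℕ) :
    ((T : ℝ) ^ 2 - 1) / 2 ≤ ∑ i ∈ Finset.range T, |(T : ℝ) - 1 - 2 * i| := by
  induction T using Nat.twoStepInduction with
  | zero => norm_num
  | one => norm_num
  | more T ih _ =>
    rw [Finset.sum_range_succ, Finset.sum_range_succ']
    have hinner : ∑ i ∈ Finset.range T, |((T + 2 : ℕ) : ℝ) - 1 - 2 * ((i + 1 : ℕ) : ℝ)| =
        ∑ i ∈ Finset.range T, |(T : ℝ) - 1 - 2 * i| :=
      Finset.sum_congr rfl fun i _ => by push_cast; ring_nf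
    rw [hinner]
    have hfirst : (T : ℝ) + 1 ≤ |((T + 2 : ℕ) : ℝ) - 1 - 2 * ((0 : ℕ) : ℝ)| :=
      le_abs.2 (Or.inl (by push_cast; linarith))
    have hlast : (T : ℝ) + 1 ≤ |((T + 2 : ℕ) : ℝ) - 1 - 2 * ((T + 1 : ℕ) : ℝ)| :=
      le_abs.2 (Or.inr (by push_cast; linarith))
    have hsq : (((T + 2 : ℕ) : ℝ) ^ 2 - 1) / 2 = ((T : ℝ) ^ 2 - 1) / 2 + (T + 1) + (T + 1) := by
      push_cast
      ring
    rw [hsq]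
    exact add_le_add (add_le_add ih hfirst) hlast

/-- For any integer `T ≥ 1`, any strictly increasing sequence of
integers `a : Fin T → ℤ` and any non-increasing sequence of reals `b : Fin T → ℝ`,
if the total absolute loss is at most `m ≥ 0`, then `T ≤ √(4m + 1)`
(i.e. the spread of the absolute loss satisfies `S_{ℓ₁}(m) ≤ √(4m+1)`). -/
theorem spread_absolute_loss (T : ℕ) (hT : 1 ≤ T)
    (a : Fin T → ℤ) (ha : StrictMono a)
    (b : Fin T → ℝ) (hb : Antitone b)
    (m : ℝ) (hm : 0 ≤ m)
    (hloss : ∑ i, |(a i : ℝ) - b i| ≤ m) :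
    (T : ℝ) ≤ Real.sqrt (4 * m + 1) := by
  have hrev : ∑ i : Fin T, |(a i.rev : ℝ) - b i.rev| = ∑ i, |(a i : ℝ) - b i| :=
    Equiv.sum_comp Fin.revPerm fun i => |(a i : ℝ) - b i|
  have hpair : ∑ i : Fin T, |(T : ℝ) - 1 - 2 * (i : ℕ)| ≤
      ∑ i : Fin T, (|(a i : ℝ) - b i| + |(a i.rev : ℝ) - b i.rev|) := by
    refine Finset.sum_le_sum fun i _ => ?_
    have h := abs_index_sub_le_abs_add_abs ha hb i i.rev
    have hdist : (T : ℝ) - 1 - 2 * (i : ℕ) = (i.rev : ℕ) - (i : ℕ) := by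
      rw [Fin.val_rev, Nat.cast_sub (Nat.succ_le_of_lt i.isLt), Nat.cast_succ]
      ring
    rw [hdist]
    exact h
  rw [Finset.sum_add_distrib, hrev,
    Fin.sum_univ_eq_sum_range (fun i => |(T : ℝ) - 1 - 2 * (i : ℝ)|)] at hpair
  apply Real.le_sqrt_of_sq_le
  linarith [sq_sub_one_div_two_le_sum_abs T]
end

section
/- Let T ≥ 3 be an integer, let a_1 < a_2 < … < a_T be a strictly increasing sequence of integers, and let b_1 ≥ b_2 ≥ … ≥ b_T be a non-increasing sequence of real numbers. If Σ_{i=1}^T (a_i − b_i)² ≤ m for some real m ≥ 0, then T ≤ (14m)^{1/3}. (Equivalently, the spread of the squared loss satisfies S_{ℓ₂}(m) ≤ (14m)^{1/3}.) -/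
/-- A strictly increasing sequence of integers grows by at least the index difference. -/
lemma StrictMono.index_sub_le {T : ℕ} {a : Fin T → ℤ} (ha : StrictMono a) {i j : Fin T}
    (hij : i ≤ j) : ((j : ℕ) : ℤ) - ((i : ℕ) : ℤ) ≤ a j - a i := by
  obtain ⟨j, hj⟩ := j
  induction j with
  | zero =>
    obtain rfl : i = ⟨0, hj⟩ := le_antisymm hij (Fin.le_def.2 (Nat.zero_le _))
    simp
  | succ k ih =>
    rcases hij.eq_or_lt with rfl | hlt
    · simp
    · have hk := ih (by omega) (Fin.le_def.2 (Nat.le_of_lt_succ (Fin.lt_def.1 hlt)))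
      have hstep : a ⟨k, by omega⟩ < a ⟨k + 1, hj⟩ := ha (Fin.mk_lt_mk.2 k.lt_succ_self)
      push_cast at hk ⊢
      omega

lemma sq_index_sub_le {T : ℕ} {a : Fin T → ℤ} (ha : StrictMono a) {b : Fin T → ℝ}
    (hb : Antitone b) (i j : Fin T) :
    (((j : ℕ) : ℝ) - ((i : ℕ) : ℝ)) ^ 2 ≤
      2 * (((a i : ℝ) - b i) ^ 2 + ((a j : ℝ) - b j) ^ 2) := by
  wlog hij : i ≤ j generalizing i j
  · linarith [this j i (le_of_not_ge hij), sub_sq_comm ((j : ℕ) : ℝ) ((i : ℕ) : ℝ)]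
  have hgap : ((j : ℕ) : ℝ) - ((i : ℕ) : ℝ) ≤ a j - a i := by
    exact_mod_cast ha.index_sub_le hij
  have hnonneg : (0 : ℝ) ≤ ((j : ℕ) : ℝ) - ((i : ℕ) : ℝ) :=
    sub_nonneg.2 (Nat.cast_le.2 hij)
  have hsq := pow_le_pow_left₀ hnonneg
    (show _ ≤ ((a j : ℝ) - b j) - (a i - b i) by linarith [hb hij]) 2
  nlinarith [sq_nonneg (((a j : ℝ) - b j) + (a i - b i))]

lemma sum_range_sub_two_mul_sq (c : ℝ) (n : ℕ) :
    3 * ∑ i ∈ Finset.range n, (c - 2 * (i : ℝ)) ^ 2 =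
      3 * n * c ^ 2 - 6 * c * (n * (n - 1)) + 2 * (n * (n - 1) * (2 * n - 1)) := by
  induction n with
  | zero => simp
  | succ n ih =>
    rw [Finset.sum_range_succ, mul_add, ih]
    push_cast
    ring

/-- For any integer `T ≥ 3`, any strictly increasing sequence of
integers `a : Fin T → ℤ` and any non-increasing sequence of reals `b : Fin T → ℝ`,
if the total squared loss is at most `m ≥ 0`, then `T ≤ (14m)^{1/3}`
(i.e. the spread of the squared loss satisfies `S_{ℓ₂}(m) ≤ (14m)^{1/3}`). -/
theorem spread_squared_loss (T : ℕ) (hT : 3 ≤ T)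
    (a : Fin T → ℤ) (ha : StrictMono a)
    (b : Fin T → ℝ) (hb : Antitone b)
    (m : ℝ) (hm : 0 ≤ m)
    (hloss : ∑ i, ((a i : ℝ) - b i) ^ 2 ≤ m) :
    (T : ℝ) ≤ (14 * m) ^ ((1 : ℝ) / 3) := by
  have hpair : ∑ i : Fin T, ((T : ℝ) - 1 - 2 * ((i : ℕ) : ℝ)) ^ 2 ≤
      ∑ i, 2 * (((a i : ℝ) - b i) ^ 2 + ((a i.rev : ℝ) - b i.rev) ^ 2) := by
    refine Finset.sum_le_sum fun i _ => ?_
    have hidx : ((i.rev : ℕ) : ℝ) = (T : ℝ) - ((i : ℕ) + 1) := by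
      rw [Fin.val_rev, Nat.cast_sub i.isLt]
      push_cast
      rfl
    have hsq := sq_index_sub_le ha hb i i.rev
    rw [hidx] at hsq
    calc ((T : ℝ) - 1 - 2 * ((i : ℕ) : ℝ)) ^ 2
        = ((T : ℝ) - ((i : ℕ) + 1) - ((i : ℕ) : ℝ)) ^ 2 := by ring
      _ ≤ _ := hsq
  have hrev : ∑ i : Fin T, ((a i.rev : ℝ) - b i.rev) ^ 2 = ∑ i, ((a i : ℝ) - b i) ^ 2 :=
    Equiv.sum_comp Fin.revPerm fun i => ((a i : ℝ) - b i) ^ 2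
  rw [← Finset.mul_sum, Finset.sum_add_distrib, hrev,
    Fin.sum_univ_eq_sum_range fun i => ((T : ℝ) - 1 - 2 * (i : ℝ)) ^ 2] at hpair
  have hsum := sum_range_sub_two_mul_sq ((T : ℝ) - 1) T
  have hT' : (3 : ℝ) ≤ T := by exact_mod_cast hT
  have hcube : (T : ℝ) ^ 3 ≤ 14 * m := by
    have hlow : (T : ℝ) ^ 3 - T ≤ 12 * m := by nlinarith
    nlinarith [mul_nonneg (sub_nonneg.2 hT') (Nat.cast_nonneg (α := ℝ) T),
      mul_nonneg (mul_nonneg (sub_nonneg.2 hT') (Nat.cast_nonneg (α := ℝ) T))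
        (Nat.cast_nonneg (α := ℝ) T)]
  rw [one_div, Real.le_rpow_inv_iff_of_pos (Nat.cast_nonneg T) (by positivity) (by norm_num)]
  exact_mod_cast hcube
end

section
/- Let T = 2n + 1 be odd with n ≥ 1. Among all pairs consisting of a strictly increasing integer sequence a_1 < … < a_T and a non-increasing real sequence b_1 ≥ … ≥ b_T, the minimum possible value of Σ_{i=1}^T |a_i − b_i| equals n(n+1), and the minimum possible value of Σ_{i=1}^T (a_i − b_i)² equals n(n+1)(2n+1)/3; both minima are attained by the pair a_i = i − 1 (i.e., A = (0, 1, …, 2n)) and b_i = n for all i. -/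
theorem StrictMono.sub_le_sub_fin {m : ℕ} {a : Fin m → ℤ} (ha : StrictMono a) {i j : Fin m}
    (hij : i ≤ j) : (j : ℤ) - i ≤ a j - a i := by
  obtain ⟨j, hj⟩ := j
  obtain ⟨k, rfl⟩ : ∃ k, j = i + k := Nat.exists_eq_add_of_le hij
  induction k with
  | zero => simp
  | succ k ih =>
    have h := ih (by omega) (Fin.mk_le_mk.2 (Nat.le_add_right _ _))
    have hlt : a ⟨i + k, by omega⟩ < a ⟨i + (k + 1), hj⟩ := ha (Fin.mk_lt_mk.2 (by omega))
    push_cast at h ⊢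
    omega

/-- The gap between mirrored entries of `a - b` is at least twice the distance to the centre. -/
theorem two_mul_abs_sub_center_le {n : ℕ} {a : Fin (2 * n + 1) → ℤ} {b : Fin (2 * n + 1) → ℝ}
    (ha : StrictMono a) (hb : Antitone b) (i : Fin (2 * n + 1)) :
    2 * |((i : ℕ) : ℝ) - n| ≤ |((a i : ℝ) - b i) - ((a i.rev : ℝ) - b i.rev)| := by
  have hrev : ((i.rev : ℕ) : ℝ) = 2 * n - (i : ℕ) := by
    have h : (i.rev : ℕ) + (i : ℕ) = 2 * n := by rw [Fin.val_rev]; omega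
    have h' : ((i.rev : ℕ) : ℝ) + (i : ℕ) = 2 * n := by exact_mod_cast h
    linarith
  rcases le_total i i.rev with h | h
  · have h₁ : ((i.rev : ℕ) : ℝ) - (i : ℕ) ≤ a i.rev - a i := by
      exact_mod_cast ha.sub_le_sub_fin h
    have h₂ := hb h
    have h₃ : ((i : ℕ) : ℝ) ≤ (i.rev : ℕ) := by exact_mod_cast h
    rw [abs_of_nonpos (by linarith : ((i : ℕ) : ℝ) - n ≤ 0)]
    exact le_trans (by linarith) (neg_le_abs _)
  · have h₁ : ((i : ℕ) : ℝ) - (i.rev : ℕ) ≤ a i - a i.rev := by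
      exact_mod_cast ha.sub_le_sub_fin h
    have h₂ := hb h
    have h₃ : ((i.rev : ℕ) : ℝ) ≤ (i : ℕ) := by exact_mod_cast h
    rw [abs_of_nonneg (by linarith : 0 ≤ ((i : ℕ) : ℝ) - n)]
    exact le_trans (by linarith) (le_abs_self _)

theorem sum_abs_sub_center (n : ℕ) :
    ∑ i : Fin (2 * n + 1), |((i : ℕ) : ℝ) - n| = (n : ℝ) * (n + 1) := by
  rw [Fin.sum_univ_eq_sum_range (fun i => |(i : ℝ) - n|)]
  induction n with
  | zero => simp
  | succ n ih =>
    rw [show 2 * (n + 1) + 1 = (2 * n + 1) + 1 + 1 by ring, Finset.sum_range_succ,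
      Finset.sum_range_succ']
    push_cast
    simp only [add_sub_add_right_eq_sub, ih]
    rw [abs_of_nonpos (by linarith [n.cast_nonneg (α := ℝ)]),
      abs_of_nonneg (by linarith [n.cast_nonneg (α := ℝ)])]
    ring

theorem sum_sq_sub_center (n : ℕ) :
    ∑ i : Fin (2 * n + 1), (((i : ℕ) : ℝ) - n) ^ 2 = (n : ℝ) * (n + 1) * (2 * n + 1) / 3 := by
  rw [Fin.sum_univ_eq_sum_range (fun i => ((i : ℝ) - n) ^ 2)]
  induction n with
  | zero => simp
  | succ n ih =>
    rw [show 2 * (n + 1) + 1 = (2 * n + 1) + 1 + 1 by ring, Finset.sum_range_succ,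
      Finset.sum_range_succ']
    push_cast
    simp only [add_sub_add_right_eq_sub, ih]
    ring

/-- A sum over `Fin m` dominates another as soon as it does so after symmetrizing under `rev`. -/
theorem sum_le_sum_of_two_mul_le_add_rev {m : ℕ} {f g : Fin m → ℝ}
    (h : ∀ i, 2 * f i ≤ g i + g i.rev) : ∑ i, f i ≤ ∑ i, g i := by
  have hsum := Finset.sum_le_sum fun i (_ : i ∈ Finset.univ) => h i
  have hrev : ∑ i : Fin m, g i.rev = ∑ i, g i := Equiv.sum_comp Fin.revPerm g
  rw [← Finset.mul_sum, Finset.sum_add_distrib, hrev] at hsum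
  linarith

/-- Let `T = 2n + 1` be odd with `n ≥ 1`.  Among all pairs of a
strictly increasing integer sequence `a` and a non-increasing real sequence `b`
of length `T`, the minimum possible absolute loss `∑ i, |a i - b i|` equals
`n(n+1)`, and the minimum possible squared loss `∑ i, (a i - b i)²` equals
`n(n+1)(2n+1)/3`; both minima are attained by the pair `a i = i`
(i.e. `A = (0, 1, …, 2n)`) and `b i = n` for all `i`. -/
theorem min_loss_odd_length (n : ℕ) (hn : 1 ≤ n) :
    IsLeast {v : ℝ | ∃ (a : Fin (2 * n + 1) → ℤ) (b : Fin (2 * n + 1) → ℝ),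
        StrictMono a ∧ Antitone b ∧ v = ∑ i, |(a i : ℝ) - b i|}
      ((n : ℝ) * (n + 1)) ∧
    IsLeast {v : ℝ | ∃ (a : Fin (2 * n + 1) → ℤ) (b : Fin (2 * n + 1) → ℝ),
        StrictMono a ∧ Antitone b ∧ v = ∑ i, ((a i : ℝ) - b i) ^ 2}
      ((n : ℝ) * (n + 1) * (2 * n + 1) / 3) ∧
    (∑ i : Fin (2 * n + 1), |((i : ℕ) : ℝ) - (n : ℝ)| = (n : ℝ) * (n + 1)) ∧
    (∑ i : Fin (2 * n + 1), (((i : ℕ) : ℝ) - (n : ℝ)) ^ 2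
        = (n : ℝ) * (n + 1) * (2 * n + 1) / 3) := by
  have hmono : StrictMono fun i : Fin (2 * n + 1) => ((i : ℕ) : ℤ) :=
    fun _ _ h => Int.ofNat_lt.2 h
  refine ⟨⟨⟨_, fun _ => n, hmono, antitone_const, ?_⟩, ?_⟩,
    ⟨⟨_, fun _ => n, hmono, antitone_const, ?_⟩, ?_⟩, sum_abs_sub_center n, sum_sq_sub_center n⟩
  · simpa using (sum_abs_sub_center n).symm
  · rintro _ ⟨a, b, ha, hb, rfl⟩
    rw [← sum_abs_sub_center n]
    exact sum_le_sum_of_two_mul_le_add_rev fun i =>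
      (two_mul_abs_sub_center_le ha hb i).trans (abs_sub _ _)
  · simpa using (sum_sq_sub_center n).symm
  · rintro _ ⟨a, b, ha, hb, rfl⟩
    rw [← sum_sq_sub_center n]
    refine sum_le_sum_of_two_mul_le_add_rev fun i => ?_
    have h := pow_le_pow_left₀ (by positivity) (two_mul_abs_sub_center_le ha hb i) 2
    rw [mul_pow, sq_abs, sq_abs] at h
    nlinarith [sq_nonneg (((a i : ℝ) - b i) + ((a i.rev : ℝ) - b i.rev))]
end

section
/- In the caching model with phases and clean elements defined below, every feasible schedule starting from the initial cache S₀ (with |S₀| = k) incurs at least L/2 cache misses on σ; in particular OPT(σ) ≥ L/2, where L is the total number of clean elements. -/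
open Finset

variable {Z : Type*}

section Caching
variable [DecidableEq Z]

/-- A feasible schedule for cache size `k`, initial cache `S0` and request
sequence `σ` (of length `n`): caches have size at most `k`, contain each request
when it arrives, and change only by inserting the requested element. -/
def IsSchedule (k n : ℕ) (S0 : Finset Z) (σ : ℕ → Z) (C : ℕ → Finset Z) : Prop :=
  C 0 = S0 ∧ ∀ i < n, (C (i + 1)).card ≤ k ∧ σ i ∈ C (i + 1) ∧ C (i + 1) ⊆ C i ∪ {σ i}

/-- Number of cache misses of the schedule `C` on requests with indices in `[s, e)`. -/
def missesIn (σ : ℕ → Z) (C : ℕ → Finset Z) (s e : ℕ) : ℕ :=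
  ((Finset.Ico s e).filter (fun i => σ i ∉ C i)).card

/-- Total number of cache misses of the schedule `C` on the request sequence. -/
def schedCost (n : ℕ) (σ : ℕ → Z) (C : ℕ → Finset Z) : ℕ := missesIn σ C 0 n

/-- The offline optimum: minimum number of misses over all feasible schedules. -/
noncomputable def OPT (k n : ℕ) (S0 : Finset Z) (σ : ℕ → Z) : ℕ :=
  sInf {c | ∃ C : ℕ → Finset Z, IsSchedule k n S0 σ C ∧ schedCost n σ C = c}

/-- End of the greedy phase starting at position `s`: the largest `e ≤ n` such that
the requests with indices in `[s, e)` contain at most `k` distinct elements. -/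
noncomputable def phaseEndPos (k n : ℕ) (σ : ℕ → Z) (s : ℕ) : ℕ :=
  sSup {e | e ≤ n ∧ ((Finset.Ico s e).image σ).card ≤ k}

/-- Start position of the `r`-th greedy phase (`0`-indexed). -/
noncomputable def phaseStart (k n : ℕ) (σ : ℕ → Z) : ℕ → ℕ
  | 0 => 0
  | r + 1 => phaseEndPos k n σ (phaseStart k n σ r)

/-- The set of distinct elements requested during phase `r`. -/
noncomputable def phaseElems (k n : ℕ) (σ : ℕ → Z) (r : ℕ) : Finset Z :=
  (Finset.Ico (phaseStart k n σ r) (phaseStart k n σ (r + 1))).image σ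

/-- Clean elements of phase `r`: requested in phase `r` but not in phase `r - 1`
(for the first phase: not in the initial cache `S0`). -/
noncomputable def cleanSet (k n : ℕ) (σ : ℕ → Z) (S0 : Finset Z) : ℕ → Finset Z
  | 0 => phaseElems k n σ 0 \ S0
  | r + 1 => phaseElems k n σ (r + 1) \ phaseElems k n σ r

/-- `L`, the total number of clean elements over all phases. -/
noncomputable def totalClean (k n : ℕ) (σ : ℕ → Z) (S0 : Finset Z) : ℕ :=
  ∑ r ∈ Finset.range n, (cleanSet k n σ S0 r).card

end Caching

section CachingLemmas
variable [DecidableEq Z]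

theorem phaseEndPos_mem (k n : ℕ) (σ : ℕ → Z) {s : ℕ} (hs : s ≤ n) :
    phaseEndPos k n σ s ≤ n ∧
      ((Ico s (phaseEndPos k n σ s)).image σ).card ≤ k :=
  Nat.sSup_mem (s := {e | e ≤ n ∧ ((Ico s e).image σ).card ≤ k})
    ⟨s, hs, by simp⟩ ⟨n, fun _ h => h.1⟩

theorem le_phaseEndPos {k n : ℕ} {σ : ℕ → Z} {s e : ℕ} (he : e ≤ n)
    (hcard : ((Ico s e).image σ).card ≤ k) : e ≤ phaseEndPos k n σ s :=
  le_csSup (s := {e | e ≤ n ∧ ((Ico s e).image σ).card ≤ k})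
    ⟨n, fun _ h => h.1⟩ ⟨he, hcard⟩

theorem le_phaseEndPos_self (k n : ℕ) (σ : ℕ → Z) {s : ℕ} (hs : s ≤ n) :
    s ≤ phaseEndPos k n σ s :=
  le_phaseEndPos hs (by simp)

theorem card_image_phase_eq {k n : ℕ} {σ : ℕ → Z} {s : ℕ} (hs : s ≤ n)
    (hlt : phaseEndPos k n σ s < n) :
    ((Ico s (phaseEndPos k n σ s)).image σ).card = k := by
  refine le_antisymm (phaseEndPos_mem k n σ hs).2 ?_
  by_contra! hc
  have hstep : ((Ico s (phaseEndPos k n σ s + 1)).image σ).card ≤ k := by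
    rw [← Finset.insert_Ico_right_eq_Ico_add_one (le_phaseEndPos_self k n σ hs), image_insert]
    exact (card_insert_le _ _).trans hc
  have := le_phaseEndPos (Nat.succ_le_of_lt hlt) hstep
  omega

theorem phaseStart_le (k n : ℕ) (σ : ℕ → Z) (r : ℕ) : phaseStart k n σ r ≤ n := by
  induction r with
  | zero => exact Nat.zero_le n
  | succ r ih => exact (phaseEndPos_mem k n σ ih).1

theorem phaseStart_le_succ (k n : ℕ) (σ : ℕ → Z) (r : ℕ) :
    phaseStart k n σ r ≤ phaseStart k n σ (r + 1) :=
  le_phaseEndPos_self k n σ (phaseStart_le k n σ r)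

theorem missesIn_add (σ : ℕ → Z) (C : ℕ → Finset Z) {a b c : ℕ} (hab : a ≤ b) (hbc : b ≤ c) :
    missesIn σ C a b + missesIn σ C b c = missesIn σ C a c := by
  unfold missesIn
  rw [← Ico_union_Ico_eq_Ico hab hbc, filter_union, card_union_of_disjoint]
  exact disjoint_filter_filter (Ico_disjoint_Ico_consecutive a b c)

namespace IsSchedule

variable {k n : ℕ} {S0 : Finset Z} {σ : ℕ → Z} {C : ℕ → Finset Z}

theorem card_le (hC : IsSchedule k n S0 σ C) (hS0 : S0.card = k) {i : ℕ} (hi : i ≤ n) :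
    (C i).card ≤ k := by
  cases i with
  | zero => rw [hC.1, hS0]
  | succ i => exact (hC.2 i hi).1

theorem subset_union_missed (hC : IsSchedule k n S0 σ C) {s e : ℕ} (hse : s ≤ e) (he : e ≤ n) :
    C e ⊆ C s ∪ ((Ico s e).filter (fun i => σ i ∉ C i)).image σ := by
  induction e, hse using Nat.le_induction with
  | base => exact subset_union_left
  | succ e hse ih =>
    intro z hz
    have ih := ih (by omega)
    have hmono : ((Ico s e).filter (fun i => σ i ∉ C i)).image σ ⊆
        ((Ico s (e + 1)).filter (fun i => σ i ∉ C i)).image σ :=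
      image_subset_image (filter_subset_filter _ (Ico_subset_Ico_right e.le_succ))
    have hstep : C e ⊆ C s ∪ ((Ico s (e + 1)).filter (fun i => σ i ∉ C i)).image σ :=
      ih.trans (union_subset_union_right hmono)
    rcases mem_union.1 ((hC.2 e he).2.2 hz) with h | h
    · exact hstep h
    · rw [mem_singleton] at h
      subst h
      by_cases hm : σ e ∈ C e
      · exact hstep hm
      · exact mem_union_right _ (mem_image_of_mem σ (mem_filter.2 ⟨by simp [hse], hm⟩))

theorem image_subset_union_missed (hC : IsSchedule k n S0 σ C) {s e : ℕ} (he : e ≤ n) :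
    (Ico s e).image σ ⊆ C s ∪ ((Ico s e).filter (fun i => σ i ∉ C i)).image σ := by
  rw [image_subset_iff]
  intro i hi
  by_cases hm : σ i ∈ C i
  · obtain ⟨hsi, hie⟩ := mem_Ico.1 hi
    refine union_subset_union_right (image_subset_image (filter_subset_filter _
      (Ico_subset_Ico_right hie.le))) (hC.subset_union_missed hsi (hie.le.trans he) hm)
  · exact mem_union_right _ (mem_image_of_mem σ (mem_filter.2 ⟨hi, hm⟩))

theorem card_image_sdiff_le (hC : IsSchedule k n S0 σ C) {s e : ℕ} (he : e ≤ n) :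
    ((Ico s e).image σ \ C s).card ≤ missesIn σ C s e :=
  (card_le_card (sdiff_le_iff.2 (hC.image_subset_union_missed he))).trans card_image_le

theorem card_cleanSet_succ_le (hC : IsSchedule k n S0 σ C) (hS0 : S0.card = k) (r : ℕ) :
    (cleanSet k n σ S0 (r + 1)).card ≤
      missesIn σ C (phaseStart k n σ r) (phaseStart k n σ (r + 2)) := by
  have h₁ := phaseStart_le_succ k n σ r
  have h₂ := phaseStart_le_succ k n σ (r + 1)
  rcases (phaseStart_le k n σ (r + 1)).lt_or_eq with hlt | heq
  · have hfull : (phaseElems k n σ r).card = k :=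
      card_image_phase_eq (phaseStart_le k n σ r) hlt
    have hcover : (Ico (phaseStart k n σ r) (phaseStart k n σ (r + 2))).image σ =
        phaseElems k n σ r ∪ phaseElems k n σ (r + 1) := by
      rw [← Ico_union_Ico_eq_Ico h₁ h₂, image_union]
      rfl
    have hmiss := hC.card_image_sdiff_le (s := phaseStart k n σ r) (phaseStart_le k n σ (r + 2))
    have hcache := hC.card_le hS0 (phaseStart_le k n σ r)
    have hdiff := le_card_sdiff (C (phaseStart k n σ r))
      ((Ico (phaseStart k n σ r) (phaseStart k n σ (r + 2))).image σ)
    have hcard := card_sdiff_add_card (phaseElems k n σ (r + 1)) (phaseElems k n σ r)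
    rw [hcover, union_comm] at hmiss hdiff
    change (phaseElems k n σ (r + 1) \ phaseElems k n σ r).card ≤ _
    omega
  · have hend := phaseStart_le k n σ (r + 2)
    have hempty : phaseElems k n σ (r + 1) = ∅ := by
      rw [phaseElems, Ico_eq_empty_of_le (hend.trans_eq heq.symm), image_empty]
    simp [cleanSet, hempty]

theorem sum_card_cleanSet_le (hC : IsSchedule k n S0 σ C) (hS0 : S0.card = k) (m : ℕ) :
    ∑ r ∈ range (m + 1), (cleanSet k n σ S0 r).card ≤
      missesIn σ C 0 (phaseStart k n σ m) + missesIn σ C 0 (phaseStart k n σ (m + 1)) := by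
  induction m with
  | zero =>
    have h := hC.card_image_sdiff_le (s := 0) (phaseStart_le k n σ 1)
    rw [hC.1] at h
    rw [sum_range_one]
    exact h.trans (Nat.le_add_left _ _)
  | succ m ih =>
    have hclean := hC.card_cleanSet_succ_le hS0 m
    have hadd := missesIn_add σ C (Nat.zero_le (phaseStart k n σ m))
      ((phaseStart_le_succ k n σ m).trans (phaseStart_le_succ k n σ (m + 1)))
    rw [sum_range_succ]
    change missesIn σ C 0 (phaseStart k n σ m) +
      missesIn σ C (phaseStart k n σ m) (phaseStart k n σ (m + 2)) = _ at hadd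
    omega

theorem totalClean_le (hC : IsSchedule k n S0 σ C) (hS0 : S0.card = k) :
    totalClean k n σ S0 ≤ 2 * schedCost n σ C := by
  have hcost (r : ℕ) : missesIn σ C 0 (phaseStart k n σ r) ≤ schedCost n σ C :=
    (Nat.le_add_right _ _).trans_eq
      (missesIn_add σ C (Nat.zero_le _) (phaseStart_le k n σ r))
  cases n with
  | zero => simp [totalClean]
  | succ m =>
    have h := hC.sum_card_cleanSet_le hS0 m
    have h₁ := hcost m
    have h₂ := hcost (m + 1)
    unfold totalClean
    omega

end IsSchedule

theorem exists_isSchedule {k : ℕ} (hk : 1 ≤ k) (n : ℕ) (S0 : Finset Z) (σ : ℕ → Z) :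
    ∃ C : ℕ → Finset Z, IsSchedule k n S0 σ C :=
  ⟨fun i => Nat.casesOn i S0 fun j => {σ j}, rfl, fun _ _ =>
    ⟨by simpa using hk, by simp, subset_union_right⟩⟩

theorem exists_schedCost_eq_OPT {k : ℕ} (hk : 1 ≤ k) (n : ℕ) (S0 : Finset Z) (σ : ℕ → Z) :
    ∃ C : ℕ → Finset Z, IsSchedule k n S0 σ C ∧ schedCost n σ C = OPT k n S0 σ := by
  obtain ⟨C, hC⟩ := exists_isSchedule hk n S0 σ
  exact Nat.sInf_mem (s := {c | ∃ C : ℕ → Finset Z,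
    IsSchedule k n S0 σ C ∧ schedCost n σ C = c}) ⟨_, C, hC, rfl⟩

end CachingLemmas

/-- In the caching model with greedy phases and clean elements,
every feasible schedule starting from the initial cache `S0` (with `|S0| = k`)
incurs at least `L/2` cache misses on `σ`; in particular `OPT(σ) ≥ L/2`, where
`L` is the total number of clean elements. -/
theorem opt_ge_half_clean [DecidableEq Z] (k n : ℕ) (hk : 1 ≤ k)
    (S0 : Finset Z) (hS0 : S0.card = k) (σ : ℕ → Z) :
    (∀ C : ℕ → Finset Z, IsSchedule k n S0 σ C →
      (totalClean k n σ S0 : ℝ) / 2 ≤ (schedCost n σ C : ℝ)) ∧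
    (totalClean k n σ S0 : ℝ) / 2 ≤ (OPT k n S0 σ : ℝ) := by
  have hbound : ∀ C : ℕ → Finset Z, IsSchedule k n S0 σ C →
      (totalClean k n σ S0 : ℝ) / 2 ≤ (schedCost n σ C : ℝ) := by
    intro C hC
    have h : (totalClean k n σ S0 : ℝ) ≤ 2 * schedCost n σ C := by
      exact_mod_cast hC.totalClean_le hS0
    linarith
  obtain ⟨C, hC, hopt⟩ := exists_schedCost_eq_OPT hk n S0 σ
  exact ⟨hbound, hopt ▸ hbound C hC⟩
end

section
/- In the caching model with phases and clean elements defined below, let D_{r} denote the set of distinct elements requested during phase r (with D₀ = S₀), and assume |D_r| = k for every phase r before the last. For any feasible schedule, let d_r^I be the number of elements in the schedule's cache at the beginning of phase r that are not in D_{r−1}, and d_r^F the number of elements in the schedule's cache at the end of phase r that are not in D_r. Then the number of cache misses the schedule incurs during phase r is at least max(ℓ_r − d_r^I, d_r^F), and hence at least (ℓ_r − d_r^I + d_r^F)/2. -/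
open Finset

variable {Z : Type*}

/-- The set of distinct elements requested in the phase preceding phase `r`
(`D_{r-1}`), with the convention that for the first phase it is the initial
cache `S0` (`D₀ = S₀` in the 1-indexed notation of the paper). -/
noncomputable def prevPhaseElems [DecidableEq Z] (k n : ℕ) (σ : ℕ → Z) (S0 : Finset Z) :
    ℕ → Finset Z
  | 0 => S0
  | r + 1 => phaseElems k n σ r

section Schedules
variable [DecidableEq Z] {k n : ℕ} {S0 : Finset Z} {σ : ℕ → Z} {C : ℕ → Finset Z}

theorem IsSchedule.cache_subset (hC : IsSchedule k n S0 σ C) {s e : ℕ} (hse : s ≤ e)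
    (hen : e ≤ n) : C e ⊆ C s ∪ (Finset.Ico s e).image σ := by
  induction e, hse using Nat.le_induction with
  | base => exact Finset.subset_union_left
  | succ e hse ih =>
    intro x hx
    have hx' := (hC.2 e (by lia)).2.2 hx
    rw [← Finset.insert_Ico_right_eq_Ico_add_one hse, Finset.image_insert]
    have := @ih (by lia) x
    simp only [Finset.mem_union, Finset.mem_singleton, Finset.mem_insert] at *
    tauto

theorem IsSchedule.card_cache_le (hC : IsSchedule k n S0 σ C) (hS0 : S0.card ≤ k) {s : ℕ}
    (hsn : s ≤ n) : (C s).card ≤ k := by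
  cases s with
  | zero => rwa [hC.1]
  | succ s => exact (hC.2 s hsn).1

/-- Every requested element absent from the cache at the start of an interval is
missed at some step of the interval. -/
theorem IsSchedule.requested_sdiff_subset (hC : IsSchedule k n S0 σ C) {s e : ℕ} (hse : s ≤ e)
    (hen : e ≤ n) : (Finset.Ico s e).image σ \ C s ⊆
      ((Finset.Ico s e).filter (fun i => σ i ∉ C i)).image σ := by
  induction e, hse using Nat.le_induction with
  | base => simp
  | succ e hse ih =>
    intro x hx
    rw [← Finset.insert_Ico_right_eq_Ico_add_one hse] at hx ⊢
    rw [Finset.image_insert, Finset.mem_sdiff, Finset.mem_insert] at hx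
    obtain ⟨hx, hxs⟩ := hx
    have hsub := Finset.image_subset_image (f := σ) (Finset.filter_subset_filter
      (fun i => σ i ∉ C i) (Finset.subset_insert e (Finset.Ico s e)))
    have hearlier : x ∈ (Finset.Ico s e).image σ → _ := fun h =>
      hsub (ih (by lia) (Finset.mem_sdiff.2 ⟨h, hxs⟩))
    rcases hx with rfl | hx
    · by_cases hmem : σ e ∈ C e
      · exact hearlier ((Finset.mem_union.1
          (hC.cache_subset hse (by lia) hmem)).resolve_left hxs)
      · exact Finset.mem_image_of_mem σ
          (Finset.mem_filter.2 ⟨Finset.mem_insert_self _ _, hmem⟩)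
    · exact hearlier hx

theorem IsSchedule.card_requested_sdiff_le_missesIn (hC : IsSchedule k n S0 σ C) {s e : ℕ}
    (hse : s ≤ e) (hen : e ≤ n) :
    ((Finset.Ico s e).image σ \ C s).card ≤ missesIn σ C s e :=
  (Finset.card_le_card (hC.requested_sdiff_subset hse hen)).trans Finset.card_image_le

theorem cleanSet_eq_sdiff (r : ℕ) :
    cleanSet k n σ S0 r = phaseElems k n σ r \ prevPhaseElems k n σ S0 r := by
  cases r <;> rfl

end Schedules

/-- Assume every phase before the last contains exactly `k`
distinct elements.  For any feasible schedule, let `dᴵ_r` be the number of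
elements in the schedule's cache at the beginning of phase `r` that are not in
`D_{r-1}`, and `dᶠ_r` the number of elements in the schedule's cache at the end
of phase `r` that are not in `D_r`.  Then the number of cache misses the
schedule incurs during any phase `r` before the last is at least
`max(ℓ_r − dᴵ_r, dᶠ_r)`, and hence at least `(ℓ_r − dᴵ_r + dᶠ_r)/2`. -/
theorem phase_miss_lower_bound [DecidableEq Z] (k n : ℕ) (hk : 1 ≤ k)
    (S0 : Finset Z) (hS0 : S0.card = k) (σ : ℕ → Z)
    (hfull : ∀ r, phaseStart k n σ (r + 1) < n → (phaseElems k n σ r).card = k)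
    (C : ℕ → Finset Z) (hC : IsSchedule k n S0 σ C) :
    ∀ r, phaseStart k n σ (r + 1) < n →
      max (((cleanSet k n σ S0 r).card : ℝ) -
            ((C (phaseStart k n σ r) \ prevPhaseElems k n σ S0 r).card : ℝ))
          (((C (phaseStart k n σ (r + 1)) \ phaseElems k n σ r).card : ℝ))
        ≤ (missesIn σ C (phaseStart k n σ r) (phaseStart k n σ (r + 1)) : ℝ) ∧
      (((cleanSet k n σ S0 r).card : ℝ) -
          ((C (phaseStart k n σ r) \ prevPhaseElems k n σ S0 r).card : ℝ) +
          ((C (phaseStart k n σ (r + 1)) \ phaseElems k n σ r).card : ℝ)) / 2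
        ≤ (missesIn σ C (phaseStart k n σ r) (phaseStart k n σ (r + 1)) : ℝ) := by
  intro r hr
  have hcard := hfull r hr
  have hse : phaseStart k n σ r ≤ phaseStart k n σ (r + 1) := by
    by_contra! hlt
    rw [phaseElems, Finset.Ico_eq_empty (by lia), Finset.image_empty, Finset.card_empty] at hcard
    lia
  have hmiss : (phaseElems k n σ r \ C (phaseStart k n σ r)).card ≤ _ :=
    hC.card_requested_sdiff_le_missesIn hse hr.le
  have hcache : C (phaseStart k n σ (r + 1)) ⊆ C (phaseStart k n σ r) ∪ phaseElems k n σ r :=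
    hC.cache_subset hse hr.le
  have hle := hC.card_cache_le hS0.le (hse.trans hr.le)
  rw [cleanSet_eq_sdiff]
  generalize phaseElems k n σ r = D at *
  generalize prevPhaseElems k n σ S0 r = P at *
  generalize missesIn σ C _ _ = m at *
  generalize C (phaseStart k n σ r) = A at *
  generalize C (phaseStart k n σ (r + 1)) = B at *
  have hclean : (D \ P).card ≤ (A \ P).card + m := by
    have hsub : D \ P ⊆ (A \ P) ∪ (D \ A) := by
      intro x
      simp only [Finset.mem_sdiff, Finset.mem_union]
      tauto
    have := (Finset.card_le_card hsub).trans (Finset.card_union_le _ _)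
    lia
  have hfinal : (B \ D).card ≤ m := by
    have hsub : B \ D ⊆ A \ D := by
      rw [← Finset.union_sdiff_right A D]
      exact Finset.sdiff_subset_sdiff hcache subset_rfl
    have := Finset.card_le_card hsub
    have := Finset.card_sdiff_le_card_sdiff_iff.2 (hle.trans hcard.ge)
    lia
  have hclean' : ((D \ P).card : ℝ) ≤ (A \ P).card + m := by exact_mod_cast hclean
  have hfinal' : ((B \ D).card : ℝ) ≤ m := by exact_mod_cast hfinal
  exact ⟨max_le (by linarith) hfinal', by linarith⟩
end

section
/- For any two deterministic online caching algorithms A and B there exists a deterministic online caching algorithm ALG such that for every request sequence σ and every prefix length t, the number of cache misses ALG incurs on the first t requests is at most 9 · min(cost_t(A), cost_t(B)), where cost_t(A) and cost_t(B) are the numbers of misses A and B incur on the first t requests. In particular, if A is α-robust and B is γ-competitive, then ALG is 9α-robust and 9γ-competitive. -/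
variable {Z : Type*} [DecidableEq Z]

/-- A deterministic online caching algorithm for cache size `k` with common
initial cache `S0`: it maps each prefix of the request sequence to a cache
state of size at most `k` that contains the last request and changes only by
inserting the requested element. -/
structure OnlineCachingAlg (Z : Type*) [DecidableEq Z] (k : ℕ) (S0 : Finset Z) where
  /-- The cache state after serving the given prefix of requests. -/
  cache : List Z → Finset Z
  cache_nil : cache [] = S0
  card_le : ∀ l, (cache l).card ≤ k
  mem_last : ∀ l z, z ∈ cache (l ++ [z])
  step : ∀ l z, cache (l ++ [z]) ⊆ cache l ∪ {z}

/-- Number of cache misses incurred by the online algorithm on the requests in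
`l`, when `pre` is the list of previously served requests. -/
def missCountAux {k : ℕ} {S0 : Finset Z} (A : OnlineCachingAlg Z k S0) :
    List Z → List Z → ℕ
  | _, [] => 0
  | pre, z :: rest =>
      (if z ∈ A.cache pre then 0 else 1) + missCountAux A (pre ++ [z]) rest

/-- Number of cache misses incurred by the online algorithm on the request
sequence `σ`. -/
def missCount {k : ℕ} {S0 : Finset Z} (A : OnlineCachingAlg Z k S0) (σ : List Z) : ℕ :=
  missCountAux A [] σ

theorem missCountAux_append_singleton {k : ℕ} {S0 : Finset Z} (A : OnlineCachingAlg Z k S0)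
    (pre l : List Z) (z : Z) :
    missCountAux A pre (l ++ [z]) =
      missCountAux A pre l + if z ∈ A.cache (pre ++ l) then 0 else 1 := by
  induction l generalizing pre with
  | nil => simp [missCountAux]
  | cons x l ih => simp [missCountAux, ih, add_assoc]

theorem missCount_append_singleton {k : ℕ} {S0 : Finset Z} (A : OnlineCachingAlg Z k S0)
    (l : List Z) (z : Z) :
    missCount A (l ++ [z]) = missCount A l + if z ∈ A.cache l then 0 else 1 := by
  simpa [missCount] using missCountAux_append_singleton A [] l z

theorem cache_subset_requested {k : ℕ} {S0 : Finset Z} (A : OnlineCachingAlg Z k S0)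
    (l : List Z) : A.cache l ⊆ S0 ∪ l.toFinset := by
  induction l using List.reverseRecOn with
  | nil => simp [A.cache_nil]
  | append_singleton l z ih =>
    intro x hx
    have h1 := A.step l z hx
    have h2 := @ih x
    simp only [Finset.mem_union, Finset.mem_singleton, List.mem_toFinset, List.mem_append,
      List.mem_singleton] at h1 h2 ⊢
    tauto

/-- Each first request of an element outside the initial cache is a miss. -/
theorem card_requested_le {k : ℕ} {S0 : Finset Z} (hS0 : S0.card = k)
    (A : OnlineCachingAlg Z k S0) (l : List Z) :
    (S0 ∪ l.toFinset).card ≤ k + missCount A l := by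
  induction l using List.reverseRecOn with
  | nil => simp [hS0]
  | append_singleton l z ih =>
    have e : S0 ∪ (l ++ [z]).toFinset = insert z (S0 ∪ l.toFinset) := by
      ext x
      simp only [Finset.mem_union, List.mem_toFinset, List.mem_append, List.mem_singleton,
        Finset.mem_insert]
      tauto
    rw [e, missCount_append_singleton]
    split_ifs with h
    · rw [Finset.insert_eq_of_mem (cache_subset_requested A l h)]
      exact ih
    · have := Finset.card_insert_le z (S0 ∪ l.toFinset)
      omega

theorem card_cache_sdiff_le {k : ℕ} {S0 : Finset Z} (hS0 : S0.card = k)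
    (A B : OnlineCachingAlg Z k S0) (l : List Z) (hB : (B.cache l).card = k) :
    (A.cache l \ B.cache l).card ≤ missCount A l := by
  have h1 := Finset.card_le_card
    (Finset.sdiff_subset_sdiff (cache_subset_requested A l) (Finset.Subset.refl (B.cache l)))
  have h2 := Finset.card_sdiff_add_card_eq_card (cache_subset_requested B l)
  have h3 := card_requested_le hS0 A l
  omega

open Classical in
/-- Serve the request `z` from cache `G`, evicting on a miss only an element outside the
target cache `T`. -/
noncomputable def follow (G T : Finset Z) (z : Z) : Finset Z :=
  if z ∈ G then G
  else if h : (G \ T).Nonempty then insert z (G.erase h.choose) else G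

theorem follow_spec {k : ℕ} {G T T' : Finset Z} {z : Z} (hG : G.card = k) (hT' : T'.card ≤ k)
    (hz : z ∈ T') (hT : T' ⊆ T ∪ {z}) :
    (follow G T' z).card = k ∧ z ∈ follow G T' z ∧ follow G T' z ⊆ G ∪ {z} ∧
      (if z ∈ G then 0 else 1) + (T' \ follow G T' z).card ≤
        (T \ G).card + (if z ∈ T then 0 else 1) := by
  by_cases hzG : z ∈ G
  · have hf : follow G T' z = G := by simp [follow, hzG]
    rw [hf]
    refine ⟨hG, hzG, Finset.subset_union_left, ?_⟩
    have : T' \ G ⊆ T \ G := by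
      intro x hx
      have h1 := @hT x
      simp only [Finset.mem_sdiff, Finset.mem_union, Finset.mem_singleton] at hx h1 ⊢
      refine ⟨(h1 hx.1).resolve_right ?_, hx.2⟩
      rintro rfl
      exact hx.2 hzG
    have := Finset.card_le_card this
    simp only [hzG, if_true]
    omega
  · have hne : (G \ T').Nonempty := by
      rw [Finset.sdiff_nonempty]
      intro hsub
      have := Finset.eq_of_subset_of_card_le hsub (by omega)
      exact hzG (this ▸ hz)
    obtain ⟨y, hy, hf⟩ : ∃ y ∈ G \ T', follow G T' z = insert z (G.erase y) :=
      ⟨hne.choose, hne.choose_spec, by simp [follow, hzG, hne]⟩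
    rw [Finset.mem_sdiff] at hy
    rw [hf]
    have hsub : T' \ insert z (G.erase y) ⊆ (T \ G).erase z := by
      intro x hx
      have h1 := @hT x
      simp only [Finset.mem_sdiff, Finset.mem_union, Finset.mem_singleton, Finset.mem_insert,
        Finset.mem_erase] at hx h1 ⊢
      have hxy : x ≠ y := by
        rintro rfl
        exact hy.2 hx.1
      tauto
    refine ⟨?_, Finset.mem_insert_self _ _, ?_, ?_⟩
    · rw [Finset.card_insert_of_notMem (by simp [hzG]), Finset.card_erase_of_mem hy.1]
      have := Finset.card_pos.mpr ⟨y, hy.1⟩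
      omega
    · intro x hx
      simp only [Finset.mem_insert, Finset.mem_erase, Finset.mem_union,
        Finset.mem_singleton] at hx ⊢
      tauto
    · have hc := Finset.card_le_card hsub
      by_cases hzT : z ∈ T
      · have hm : z ∈ T \ G := Finset.mem_sdiff.mpr ⟨hzT, hzG⟩
        rw [Finset.card_erase_of_mem hm] at hc
        have := Finset.card_pos.mpr ⟨z, hm⟩
        simp only [hzG, hzT, if_true, if_false]
        omega
      · have := Finset.card_erase_le (s := T \ G) (a := z)
        simp only [hzG, hzT, if_false]
        omega

/-- Which of `A` (`true`) and `B` (`false`) to follow after serving `l`, having followed `m`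
before: the followed algorithm is abandoned once it has more than twice the misses of the
other one. -/
def nextMode {k : ℕ} {S0 : Finset Z} (A B : OnlineCachingAlg Z k S0) (m : Bool) (l : List Z) :
    Bool :=
  if m then decide (missCount A l ≤ 2 * missCount B l)
  else decide (2 * missCount A l < missCount B l)

/-- Cache and followed algorithm of the combination of `A` and `B`, on the reversed request
sequence. -/
noncomputable def combineState {k : ℕ} {S0 : Finset Z} (A B : OnlineCachingAlg Z k S0) :
    List Z → Finset Z × Bool
  | [] => (S0, true)
  | z :: r =>
    let m := nextMode A B (combineState A B r).2 (r.reverse ++ [z])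
    (follow (combineState A B r).1 ((if m then A else B).cache (r.reverse ++ [z])) z, m)

theorem card_combineState {k : ℕ} {S0 : Finset Z} (hS0 : S0.card = k)
    (A B : OnlineCachingAlg Z k S0) (r : List Z) : (combineState A B r).1.card = k := by
  induction r with
  | nil => exact hS0
  | cons z r ih =>
    exact (follow_spec ih (OnlineCachingAlg.card_le _ _) (OnlineCachingAlg.mem_last _ _ _)
      (OnlineCachingAlg.step _ _ _)).1

/-- The online algorithm that follows `A` and `B` alternately. -/
noncomputable def combine {k : ℕ} {S0 : Finset Z} (hS0 : S0.card = k)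
    (A B : OnlineCachingAlg Z k S0) : OnlineCachingAlg Z k S0 where
  cache l := (combineState A B l.reverse).1
  cache_nil := rfl
  card_le l := (card_combineState hS0 A B _).le
  mem_last l z := by
    rw [List.reverse_append]
    exact (follow_spec (card_combineState hS0 A B _) (OnlineCachingAlg.card_le _ _)
      (OnlineCachingAlg.mem_last _ _ _) (OnlineCachingAlg.step _ _ _)).2.1
  step l z := by
    rw [List.reverse_append]
    exact (follow_spec (card_combineState hS0 A B _) (OnlineCachingAlg.card_le _ _)
      (OnlineCachingAlg.mem_last _ _ _) (OnlineCachingAlg.step _ _ _)).2.2.1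

theorem combine_follow_cost {k : ℕ} {S0 : Finset Z} (hS0 : S0.card = k)
    (A B X : OnlineCachingAlg Z k S0) (l : List Z) (z : Z)
    (hX : (if (combineState A B (l ++ [z]).reverse).2 then A else B) = X) :
    missCount (combine hS0 A B) (l ++ [z]) +
        (X.cache (l ++ [z]) \ (combine hS0 A B).cache (l ++ [z])).card + missCount X l ≤
      missCount (combine hS0 A B) l + (X.cache l \ (combine hS0 A B).cache l).card +
        missCount X (l ++ [z]) := by
  have hc : (combine hS0 A B).cache (l ++ [z]) =
      follow ((combine hS0 A B).cache l) (X.cache (l ++ [z])) z := by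
    subst hX
    simp [combine, combineState]
  have h := (follow_spec (card_combineState hS0 A B l.reverse) (X.card_le (l ++ [z]))
    (X.mem_last l z) (X.step l z)).2.2.2
  change _ + (X.cache (l ++ [z]) \ follow ((combine hS0 A B).cache l) _ z).card ≤
    (X.cache l \ (combine hS0 A B).cache l).card + _ at h
  rw [← hc] at h
  change (if z ∈ (combine hS0 A B).cache l then 0 else 1) + _ ≤ _ at h
  rw [missCount_append_singleton, missCount_append_singleton X]
  omega

theorem combine_invariant {k : ℕ} {S0 : Finset Z} (hS0 : S0.card = k)
    (A B : OnlineCachingAlg Z k S0) (l : List Z) :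
    if (combineState A B l.reverse).2 then
      missCount A l ≤ 2 * missCount B l ∧
      missCount (combine hS0 A B) l + (A.cache l \ (combine hS0 A B).cache l).card ≤
        min (5 * missCount A l) (missCount A l + 2 * missCount B l)
    else
      missCount B l ≤ 2 * missCount A l ∧
      missCount (combine hS0 A B) l + (B.cache l \ (combine hS0 A B).cache l).card ≤
        min (5 * missCount B l) (missCount B l + 2 * missCount A l) := by
  induction l using List.reverseRecOn with
  | nil => simp [combineState, missCount, missCountAux, A.cache_nil, OnlineCachingAlg.cache_nil]
  | append_singleton l z ih =>
    have hk := card_combineState hS0 A B l.reverse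
    have hA := card_cache_sdiff_le hS0 A (combine hS0 A B) l hk
    have hB := card_cache_sdiff_le hS0 B (combine hS0 A B) l hk
    have hm : (combineState A B (l ++ [z]).reverse).2 =
        nextMode A B (combineState A B l.reverse).2 (l ++ [z]) := by
      simp [combineState]
    have hf := combine_follow_cost hS0 A B _ l z rfl
    have hsA : missCount A l ≤ missCount A (l ++ [z]) ∧
        missCount A (l ++ [z]) ≤ missCount A l + 1 := by
      rw [missCount_append_singleton]; split_ifs <;> omega
    have hsB : missCount B l ≤ missCount B (l ++ [z]) ∧
        missCount B (l ++ [z]) ≤ missCount B l + 1 := by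
      rw [missCount_append_singleton]; split_ifs <;> omega
    rw [hm] at hf ⊢
    cases hold : (combineState A B l.reverse).2 <;>
      cases hnew : nextMode A B (combineState A B l.reverse).2 (l ++ [z]) <;>
      rw [hold] at ih hnew <;> rw [hold, hnew] at hf <;> rw [hnew] <;>
      simp [nextMode] at hnew ih hf ⊢ <;> omega

/-- For any two deterministic online caching algorithms `A`
and `B` (with common cache size `k` and common initial cache `S0` of size `k`)
there exists a deterministic online caching algorithm `ALG` such that for every
request sequence `σ` and every prefix length `t`, the number of cache misses
`ALG` incurs on the first `t` requests is at most
`9 · min(cost_t(A), cost_t(B))`.  (In particular, if `A` is `α`-robust and `B`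
is `γ`-competitive, then `ALG` is `9α`-robust and `9γ`-competitive.) -/
theorem black_box_combination (k : ℕ) (hk : 1 ≤ k) (S0 : Finset Z) (hS0 : S0.card = k)
    (A B : OnlineCachingAlg Z k S0) :
    ∃ ALG : OnlineCachingAlg Z k S0, ∀ (σ : List Z) (t : ℕ),
      missCount ALG (σ.take t) ≤ 9 * min (missCount A (σ.take t)) (missCount B (σ.take t)) := by
  refine ⟨combine hS0 A B, fun σ t => ?_⟩
  have h := combine_invariant hS0 A B (σ.take t)
  split_ifs at h <;> omega
end

section
/- For every even integer T ≥ 4 there exist a universe of 3 elements, cache size k = 2, an initial cache, a request sequence σ of length T, and oracle predictions of next-arrival times with total absolute loss η₁ ≤ T (so average loss η₁/T ≤ 1), such that the BlindOracle algorithm incurs at least T − 1 cache misses on σ while OPT(σ) = 1. Consequently the competitive ratio of BlindOracle is unbounded even when the average absolute loss of the oracle is at most 1. -/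
open Finset

variable {Z : Type*}

open scoped Classical

/-- True next arrival time of the element requested at position `i`:
`y_i = min {τ > i : σ τ = σ i}` (and `n`, i.e. one past the end of the
`0`-indexed sequence of length `n`, if the element is never requested again). -/
noncomputable def nextArrival (n : ℕ) (σ : ℕ → Z) (i : ℕ) : ℕ :=
  sInf ({τ | i < τ ∧ τ < n ∧ σ τ = σ i} ∪ {n})

/-- The cached element with the largest stored prediction (ties broken towards
the largest element in the linear order on `Z`). -/
noncomputable def argmaxPred [LinearOrder Z] [Nonempty Z] (p : Z → ℝ) (U : Finset Z) : Z :=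
  if h : U.Nonempty then
    (U.filter fun z => U.sup' h p ≤ p z).max' (by
      obtain ⟨w, hw, he⟩ := Finset.exists_mem_eq_sup' h p
      exact ⟨w, Finset.mem_filter.2 ⟨hw, he.le⟩⟩)
  else Classical.arbitrary Z

/-- Number of cache misses of the BlindOracle algorithm on the remaining list of
requests paired with their predicted next-arrival times, from cache `C` with
stored predictions `p`: on a cache miss (with a full cache) it evicts the cached
element whose stored predicted next-arrival time is furthest in the future. -/
noncomputable def blindOracleMisses [LinearOrder Z] [Nonempty Z] (k : ℕ) :
    List (Z × ℝ) → Finset Z → (Z → ℝ) → ℕ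
  | [], _, _ => 0
  | (z, hz) :: rest, C, p =>
    let p' := Function.update p z hz
    if z ∈ C then blindOracleMisses k rest C p'
    else if C.card < k then 1 + blindOracleMisses k rest (insert z C) p'
    else 1 + blindOracleMisses k rest (insert z (C.erase (argmaxPred p' C))) p'
  termination_by l => l.length

theorem nextArrival_pos {n : ℕ} (hn : 0 < n) (σ : ℕ → Z) (i : ℕ) : 0 < nextArrival n σ i := by
  have hmem : nextArrival n σ i ∈ {τ | i < τ ∧ τ < n ∧ σ τ = σ i} ∪ {n} :=
    Nat.sInf_mem ⟨n, Or.inr rfl⟩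
  rcases hmem with h | h
  · exact (Nat.zero_le i).trans_lt h.1
  · rw [Set.mem_singleton_iff.1 h]
    exact hn

theorem nextArrival_eq_of_forall_ne {n : ℕ} {σ : ℕ → Z} {i : ℕ}
    (h : ∀ j, i < j → σ j ≠ σ i) : nextArrival n σ i = n := by
  have hempty : {τ | i < τ ∧ τ < n ∧ σ τ = σ i} = ∅ :=
    Set.eq_empty_of_forall_notMem fun j hj => h j hj.1 hj.2.2
  rw [nextArrival, hempty, Set.empty_union, csInf_singleton]

theorem argmaxPred_eq [LinearOrder Z] [Nonempty Z] {p : Z → ℝ} {U : Finset Z} {x : Z}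
    (hx : x ∈ U) (h : ∀ y ∈ U, y ≠ x → p y < p x) : argmaxPred p U = x := by
  have hU : U.Nonempty := ⟨x, hx⟩
  rw [argmaxPred, dif_pos hU]
  have hmem := Finset.max'_mem (U.filter fun z => U.sup' hU p ≤ p z) (by
    obtain ⟨w, hw, he⟩ := Finset.exists_mem_eq_sup' hU p
    exact ⟨w, Finset.mem_filter.2 ⟨hw, he.le⟩⟩)
  rw [Finset.mem_filter] at hmem
  by_contra hne
  exact absurd ((Finset.le_sup' p hx).trans hmem.2) (h _ hmem.1 hne).not_ge

/-- If the requests alternate between two elements and a third, never requested, element `c`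
is cached with a smaller stored prediction, then BlindOracle with cache size `2` misses every
request. -/
theorem blindOracleMisses_alternating [LinearOrder Z] [Nonempty Z] {c : Z} {σ : ℕ → Z}
    {h : ℕ → ℝ} (n s : ℕ) {p : Z → ℝ}
    (hc : ∀ i, s ≤ i → σ i ≠ c) (hne : ∀ i, s ≤ i → σ (i + 1) ≠ σ i)
    (hper : ∀ i, s ≤ i → σ (i + 2) = σ i)
    (hh : ∀ i, s ≤ i → p c < h i) (hp : p c < p (σ (s + 1))) :
    blindOracleMisses 2 ((List.range' s n).map fun i => (σ i, h i)) {c, σ (s + 1)} p = n := by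
  induction n generalizing s p with
  | zero => simp [blindOracleMisses]
  | succ n ih =>
    have h0 := hc s le_rfl
    have h1 := hne s le_rfl
    have h2 := hc (s + 1) (by omega)
    have hcard : ({c, σ (s + 1)} : Finset Z).card = 2 := Finset.card_pair h2.symm
    have hpc : Function.update p (σ s) (h s) c = p c := Function.update_of_ne h0.symm _ _
    have hpx : Function.update p (σ s) (h s) (σ (s + 1)) = p (σ (s + 1)) :=
      Function.update_of_ne h1 _ _
    have harg : argmaxPred (Function.update p (σ s) (h s)) {c, σ (s + 1)} = σ (s + 1) := by
      refine argmaxPred_eq (by simp) fun y hy hyx => ?_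
      obtain rfl : y = c := by simpa [hyx] using hy
      rwa [hpc, hpx]
    have hcache : insert (σ s) (({c, σ (s + 1)} : Finset Z).erase (σ (s + 1))) =
        {c, σ (s + 1 + 1)} := by
      ext y
      simp only [Finset.mem_insert, Finset.mem_erase, Finset.mem_singleton, hper s le_rfl]
      grind
    have hmiss : σ s ∉ ({c, σ (s + 1)} : Finset Z) := by simp [h0, h1.symm]
    rw [List.range'_succ, List.map_cons, blindOracleMisses]
    simp only [hmiss, if_false, hcard, lt_irrefl, harg]
    rw [hcache, ih (s + 1) (fun i hi => hc i (by omega)) (fun i hi => hne i (by omega))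
      (fun i hi => hper i (by omega))
      (fun i hi => by rw [hpc]; exact hh i (by omega))
      (by rw [hpc, hper s le_rfl, Function.update_self]; exact hh s le_rfl), add_comm]

/-- The optimum is `1` when an initially cached element is requested once, followed by
requests to the other cached element and one uncached element. -/
theorem OPT_two_eq_one [DecidableEq Z] {a b c : Z} {σ : ℕ → Z} {n : ℕ} (hn : 2 ≤ n)
    (hab : a ≠ b) (hbc : b ≠ c) (h0 : σ 0 = c) (h1 : σ 1 = b)
    (hσ : ∀ i, 2 ≤ i → σ i = a ∨ σ i = b) : OPT 2 n {a, c} σ = 1 := by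
  have hsched : 1 ∈ {m | ∃ C : ℕ → Finset Z,
      IsSchedule 2 n {a, c} σ C ∧ schedCost n σ C = m} := by
    refine ⟨fun i => if i ≤ 1 then {a, c} else {a, b}, ⟨by simp, ?_⟩, ?_⟩
    · intro i _
      obtain rfl | rfl | hi : i = 0 ∨ i = 1 ∨ 2 ≤ i := by omega
      · simp [h0, Finset.card_le_two]
      · simp [h1, Finset.card_le_two, Finset.insert_subset_iff]
      · have : ¬ i ≤ 1 := by omega
        have : i ≠ 0 := by omega
        rcases hσ i hi with h | h <;> simp [*, Finset.card_le_two, Finset.pair_comm]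
    · rw [schedCost, missesIn, Finset.card_eq_one]
      refine ⟨1, ?_⟩
      ext i
      obtain rfl | rfl | hi : i = 0 ∨ i = 1 ∨ 2 ≤ i := by omega
      · simp [h0]
      · simp [h1, hab.symm, hbc]
        omega
      · have : ¬ i ≤ 1 := by omega
        have : i ≠ 1 := by omega
        rcases hσ i hi with h | h <;> simp [*]
  refine le_antisymm (Nat.sInf_le hsched) (le_csInf ⟨1, hsched⟩ ?_)
  rintro _ ⟨C, ⟨hC0, hC⟩, rfl⟩
  have h1n : 1 ∈ Finset.Ico 0 n := Finset.mem_Ico.2 ⟨zero_le_one, hn⟩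
  refine Finset.card_pos.2 ⟨1, Finset.mem_filter.2 ⟨h1n, fun hmem => ?_⟩⟩
  have := (hC 0 (by omega)).2.2 (h1 ▸ hmem)
  simp [hC0, h0, hab.symm, hbc] at this

/-- For every even integer `T ≥ 4` there exist a universe of
`3` elements, cache size `k = 2`, an initial cache `S0` (with initial stored
predictions `p0`), a request sequence `σ` of length `T`, and oracle predictions
`h` of next-arrival times with total absolute loss `η₁ ≤ T` (so average loss
`η₁/T ≤ 1`), such that the BlindOracle algorithm incurs at least `T − 1` cache
misses on `σ` while `OPT(σ) = 1`.  Consequently the competitive ratio of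
BlindOracle is unbounded even when the average absolute loss of the oracle is
at most `1`. -/
theorem blind_oracle_bad (T : ℕ) (hT : 4 ≤ T) (hTeven : Even T) :
    ∃ (S0 : Finset (Fin 3)) (σ : ℕ → Fin 3) (p0 : Fin 3 → ℝ) (h : ℕ → ℝ),
      S0.card = 2 ∧
      (∑ i ∈ Finset.range T, |(nextArrival T σ i : ℝ) - h i|) ≤ (T : ℝ) ∧
      T - 1 ≤ blindOracleMisses 2 ((List.range T).map fun i => (σ i, h i)) S0 p0 ∧
      OPT 2 T S0 σ = 1 := by
  let σ : ℕ → Fin 3 := fun i => if i = 0 then 2 else if i % 2 = 1 then 1 else 0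
  let h : ℕ → ℝ := fun i => if i = 0 then 0 else nextArrival T σ i
  have hσ : ∀ i, 1 ≤ i → σ i = if i % 2 = 1 then 1 else 0 := fun i hi => if_neg (by omega)
  have hσ2 : ∀ i, 1 ≤ i → σ i ≠ 2 := by
    intro i hi
    rw [hσ i hi]
    split_ifs <;> simp
  have hpos : ∀ i, 1 ≤ i → 0 < h i := by
    intro i hi
    have : i ≠ 0 := by omega
    simpa [h, this] using nextArrival_pos (show 0 < T by omega) σ i
  refine ⟨{0, 2}, σ, ![2, 1, 0], h, Finset.card_pair (by simp), ?_, ?_, ?_⟩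
  · rw [Finset.sum_eq_single_of_mem 0 (by simp; omega)
      (fun i _ hi => by simp [h, hi]),
      nextArrival_eq_of_forall_ne fun j hj => hσ2 j hj]
    simp [h]
  · obtain ⟨n, rfl⟩ : ∃ n, T = n + 1 := ⟨T - 1, by omega⟩
    have hup : Function.update (![2, 1, 0] : Fin 3 → ℝ) 2 0 = ![2, 1, 0] := by
      ext i
      fin_cases i <;> simp [Function.update]
    have key := blindOracleMisses_alternating (c := 2) (σ := σ) (h := h) (p := ![2, 1, 0]) n 1
      hσ2
      (fun i hi => by
        rw [hσ i hi, hσ (i + 1) (by omega)]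
        rcases Nat.mod_two_eq_zero_or_one i with hm | hm <;> simp [Nat.add_mod, hm])
      (fun i hi => by rw [hσ i hi, hσ (i + 2) (by omega), Nat.add_mod_right])
      (by simpa using hpos) (by simp [σ])
    rw [List.range_eq_range', List.range'_succ, List.map_cons, blindOracleMisses]
    have hmem : σ 0 ∈ ({0, 2} : Finset (Fin 3)) := by simp [σ]
    have hcache : ({0, 2} : Finset (Fin 3)) = {2, σ (1 + 1)} := by
      simp [σ, Finset.pair_comm]
    have hup' : Function.update (![2, 1, 0] : Fin 3 → ℝ) (σ 0) (h 0) = ![2, 1, 0] := hup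
    simp only [hmem, if_true, hup']
    rw [hcache, zero_add, key]
    simp
  · refine OPT_two_eq_one (a := 0) (b := 1) (c := 2) (n := T) (by omega) (by simp) (by simp)
      (by simp [σ]) (by simp [σ]) ?_
    intro i hi
    rw [hσ i (by omega)]
    split_ifs <;> simp
end

section
/- For every integer r₀ ≥ 2 there exist a universe of 4 elements, cache size k = 3, an initial cache, a request sequence σ of length T with T ≥ 2^{r₀}, and oracle predictions of next-arrival times with total absolute loss η₁ ≤ 3T (so average loss η₁/T ≤ 3), such that the FixedBlindOracle algorithm incurs at least log₂(T) − 2 cache misses on σ while OPT(σ) ≤ 2. Consequently the competitive ratio of FixedBlindOracle is unbounded even when the average absolute loss of the oracle is at most a constant. -/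
open Finset

variable {Z : Type*}

open scoped Classical

/-- Number of cache misses of the FixedBlindOracle algorithm on the remaining
list of requests paired with their predicted next-arrival times, from cache `C`
with stored predictions `p`, where `t` is the current time: on a cache miss
(with a full cache), if the set `S_t` of cached elements whose stored predicted
next-arrival time is strictly earlier than `t` is nonempty, it evicts an element
of `S_t`; otherwise it evicts the cached element with the furthest stored
predicted next-arrival time. -/
noncomputable def fixedBlindMisses [LinearOrder Z] [Nonempty Z] (k : ℕ) :
    List (Z × ℝ) → ℕ → Finset Z → (Z → ℝ) → ℕ
  | [], _, _, _ => 0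
  | (z, hz) :: rest, t, C, p =>
    let p' := Function.update p z hz
    if z ∈ C then fixedBlindMisses k rest (t + 1) C p'
    else if C.card < k then 1 + fixedBlindMisses k rest (t + 1) (insert z C) p'
    else
      let St := C.filter fun w => p' w < (t : ℝ)
      let e := if hSt : St.Nonempty then St.min' hSt else argmaxPred p' C
      1 + fixedBlindMisses k rest (t + 1) (insert z (C.erase e)) p'
  termination_by l => l.length

/-- If the request is not cached, the cache is full and exactly one cached element has an expired
prediction, then FixedBlindOracle evicts that element. -/
lemma fixedBlindMisses_cons_of_expired [LinearOrder Z] [Nonempty Z] {k : ℕ} {z e : Z} {hz : ℝ}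
    {rest : List (Z × ℝ)} {t : ℕ} {C : Finset Z} {p : Z → ℝ} (hzC : z ∉ C) (hC : ¬ C.card < k)
    (he : (C.filter fun w => p w < (t : ℝ)) = {e}) :
    fixedBlindMisses k ((z, hz) :: rest) t C p =
      1 + fixedBlindMisses k rest (t + 1) (insert z (C.erase e)) (Function.update p z hz) := by
  have he' : (C.filter fun w => Function.update p z hz w < (t : ℝ)) = {e} := by
    rw [← he]
    refine Finset.filter_congr fun w hw => ?_
    rw [Function.update_of_ne (ne_of_mem_of_not_mem hw hzC)]
  rw [fixedBlindMisses]
  simp only [hzC, hC, if_false]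
  have hne : (C.filter fun w => Function.update p z hz w < (t : ℝ)).Nonempty := by simp [he']
  rw [dif_pos hne]
  simp only [he', Finset.min'_singleton]

/-- The request sequence `0, 1, 2, 0, 1, 2, …` in a universe of four elements. -/
def cyclicRequest (i : ℕ) : Fin 4 := Fin.ofNat 4 (i % 3)

lemma cyclicRequest_add_three (i : ℕ) : cyclicRequest (i + 3) = cyclicRequest i := by
  simp [cyclicRequest]

lemma cyclicRequest_cases (t : ℕ) :
    (cyclicRequest t = 0 ∧ cyclicRequest (t + 1) = 1 ∧ cyclicRequest (t + 2) = 2) ∨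
    (cyclicRequest t = 1 ∧ cyclicRequest (t + 1) = 2 ∧ cyclicRequest (t + 2) = 0) ∨
    (cyclicRequest t = 2 ∧ cyclicRequest (t + 1) = 0 ∧ cyclicRequest (t + 2) = 1) := by
  have h : t % 3 = 0 ∨ t % 3 = 1 ∨ t % 3 = 2 := by omega
  rcases h with h | h | h <;> simp [cyclicRequest, Nat.add_mod, h] <;> decide

/-- If every request is predicted to return in the next step, and the never requested element `3`
is cached with a late prediction, then FixedBlindOracle misses on every cyclic request. -/
lemma fixedBlindMisses_cyclicRequest (m t : ℕ) (p : Fin 4 → ℝ)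
    (hp₁ : p (cyclicRequest (t + 1)) < t) (hp₂ : p (cyclicRequest (t + 2)) = t)
    (hp₃ : (t : ℝ) + m ≤ p 3) :
    fixedBlindMisses 3 ((List.range' t m).map fun i => (cyclicRequest i, (i : ℝ) + 1)) t
      {cyclicRequest (t + 1), cyclicRequest (t + 2), 3} p = m := by
  induction m generalizing t p with
  | zero => simp [fixedBlindMisses]
  | succ m ih =>
    have hdist : cyclicRequest t ≠ cyclicRequest (t + 1) ∧ cyclicRequest t ≠ cyclicRequest (t + 2) ∧
        cyclicRequest t ≠ 3 ∧ cyclicRequest (t + 1) ≠ cyclicRequest (t + 2) ∧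
        cyclicRequest (t + 1) ≠ 3 ∧ cyclicRequest (t + 2) ≠ 3 := by
      rcases cyclicRequest_cases t with ⟨h₀, h₁, h₂⟩ | ⟨h₀, h₁, h₂⟩ | ⟨h₀, h₁, h₂⟩ <;>
        rw [h₀, h₁, h₂] <;> decide
    obtain ⟨h01, h02, h03, h12, h13, h23⟩ := hdist
    push_cast at hp₃
    have hm : (0 : ℝ) ≤ m := m.cast_nonneg
    rw [List.range'_succ, List.map_cons,
      fixedBlindMisses_cons_of_expired (e := cyclicRequest (t + 1))]
    · have hcache : insert (cyclicRequest t)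
          (({cyclicRequest (t + 1), cyclicRequest (t + 2), 3} : Finset (Fin 4)).erase
            (cyclicRequest (t + 1))) =
          {cyclicRequest (t + 1 + 1), cyclicRequest (t + 1 + 2), 3} := by
        rw [show t + 1 + 2 = t + 3 from rfl, cyclicRequest_add_three,
          Finset.erase_insert (by simp [h12, h13]), Finset.insert_comm]
      rw [hcache, ih, add_comm]
      · rw [Function.update_of_ne h02.symm]
        rw [hp₂]
        push_cast
        linarith
      · rw [show t + 1 + 2 = t + 3 from rfl, cyclicRequest_add_three, Function.update_self]
        push_cast
        rfl
      · rw [Function.update_of_ne h03.symm]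
        push_cast
        linarith
    · simp [h01, h02, h03]
    · simp [h12, h13, h23]
    · ext w
      simp only [Finset.mem_filter, Finset.mem_insert, Finset.mem_singleton]
      constructor
      · rintro ⟨rfl | rfl | rfl, hw⟩
        · rfl
        · exact absurd hw hp₂.not_lt
        · linarith
      · rintro rfl
        exact ⟨Or.inl rfl, hp₁⟩

lemma abs_nextArrival_cyclicRequest_sub_le (T i : ℕ) (hi : i < T) :
    |(nextArrival T cyclicRequest i : ℝ) - (i + 1)| ≤ 3 := by
  set S := {τ | i < τ ∧ τ < T ∧ cyclicRequest τ = cyclicRequest i} ∪ {T} with hS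
  have hlow : i + 1 ≤ nextArrival T cyclicRequest i := by
    have hmem : sInf S ∈ S := Nat.sInf_mem ⟨T, Or.inr rfl⟩
    rcases hmem with h | h
    · exact h.1
    · exact hi.trans_eq h.symm
  have hup : nextArrival T cyclicRequest i ≤ i + 3 := by
    by_cases h : i + 3 < T
    · exact Nat.sInf_le (Or.inl ⟨by omega, h, cyclicRequest_add_three i⟩)
    · exact (Nat.sInf_le (Or.inr rfl)).trans (not_lt.1 h)
  have hlow' : ((i : ℝ) + 1) ≤ nextArrival T cyclicRequest i := by exact_mod_cast hlow
  have hup' : (nextArrival T cyclicRequest i : ℝ) ≤ i + 3 := by exact_mod_cast hup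
  rw [abs_le]
  constructor <;> linarith

lemma cyclicRequest_mem (i : ℕ) : cyclicRequest i ∈ ({0, 1, 2} : Finset (Fin 4)) := by
  rcases cyclicRequest_cases i with h | h | h <;> simp [h.1]

lemma OPT_cyclicRequest_le_one (T : ℕ) : OPT 3 T {1, 2, 3} cyclicRequest ≤ 1 := by
  let C : ℕ → Finset (Fin 4) := fun i => if i = 0 then {1, 2, 3} else {0, 1, 2}
  have hC : IsSchedule 3 T {1, 2, 3} cyclicRequest C := by
    refine ⟨rfl, fun i _ => ⟨by simp [C], by simpa [C] using cyclicRequest_mem i, ?_⟩⟩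
    rcases Nat.eq_zero_or_pos i with rfl | hi
    · have h0 : cyclicRequest 0 = 0 := rfl
      simp only [C, h0]
      decide
    · simp [C, hi.ne']
  have hOPT : OPT 3 T {1, 2, 3} cyclicRequest ≤ schedCost T cyclicRequest C :=
    Nat.sInf_le ⟨C, hC, rfl⟩
  refine hOPT.trans ?_
  rw [schedCost, missesIn]
  refine (Finset.card_le_card (t := {0}) fun i hi => ?_).trans_eq (Finset.card_singleton 0)
  by_contra h0
  rw [Finset.mem_singleton] at h0
  exact (Finset.mem_filter.1 hi).2 (by simpa [C, h0] using cyclicRequest_mem i)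

/-- For every integer `r₀ ≥ 2` there exist a universe of `4`
elements, cache size `k = 3`, an initial cache `S0` (with initial stored
predictions `p0`), a request sequence `σ` of length `T ≥ 2^{r₀}`, and oracle
predictions `h` of next-arrival times with total absolute loss `η₁ ≤ 3T` (so
average loss `η₁/T ≤ 3`), such that the FixedBlindOracle algorithm incurs at
least `log₂ T − 2` cache misses on `σ` while `OPT(σ) ≤ 2`.  Consequently the
competitive ratio of FixedBlindOracle is unbounded even when the average
absolute loss of the oracle is at most a constant. -/
theorem fixed_blind_oracle_bad (r₀ : ℕ) (hr₀ : 2 ≤ r₀) :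
    ∃ (T : ℕ), 2 ^ r₀ ≤ T ∧
    ∃ (S0 : Finset (Fin 4)) (σ : ℕ → Fin 4) (p0 : Fin 4 → ℝ) (h : ℕ → ℝ),
      S0.card = 3 ∧
      (∑ i ∈ Finset.range T, |(nextArrival T σ i : ℝ) - h i|) ≤ 3 * (T : ℝ) ∧
      Real.logb 2 T - 2
        ≤ (fixedBlindMisses 3 ((List.range T).map fun i => (σ i, h i)) 0 S0 p0 : ℝ) ∧
      OPT 3 T S0 σ ≤ 2 := by
  refine ⟨2 ^ r₀, le_rfl, {1, 2, 3}, cyclicRequest, ![0, -1, 0, 2 ^ r₀], fun i => (i : ℝ) + 1,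
    rfl, ?_, ?_, (OPT_cyclicRequest_le_one _).trans one_le_two⟩
  · refine (Finset.sum_le_card_nsmul _ _ 3 fun i hi =>
      abs_nextArrival_cyclicRequest_sub_le _ i (Finset.mem_range.1 hi)).trans_eq ?_
    simp [mul_comm]
  · have h := fixedBlindMisses_cyclicRequest (2 ^ r₀) 0 ![0, -1, 0, 2 ^ r₀]
      (by
        rw [show cyclicRequest (0 + 1) = 1 from rfl]
        simp)
      (by
        rw [show cyclicRequest (0 + 2) = 2 from rfl]
        simp)
      (by simp)
    rw [← List.range_eq_range'] at h
    have hlog : Real.logb 2 ((2 ^ r₀ : ℕ) : ℝ) = r₀ := by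
      rw [Nat.cast_pow, Nat.cast_ofNat, Real.logb_pow, Real.logb_self_eq_one one_lt_two, mul_one]
    have hcache : ({1, 2, 3} : Finset (Fin 4)) =
        {cyclicRequest (0 + 1), cyclicRequest (0 + 2), 3} := rfl
    rw [hcache, h, hlog]
    have hlt : (r₀ : ℝ) < ((2 ^ r₀ : ℕ) : ℝ) := by exact_mod_cast Nat.lt_two_pow_self
    linarith
end

section
/- Run any eviction algorithm on a request sequence while maintaining the Marker bookkeeping (mark bits cleared at each phase start; a requested element currently in the cache is marked; an element inserted on a miss is marked; a new phase starts when the cache is full, all cached elements are marked, and a miss occurs). Then at every point in time, every marked cached element was last requested strictly more recently than every unmarked cached element. Consequently, on any cache miss at which the cache contains at least one unmarked element, the least recently requested cached element is unmarked; in particular, the LRU rule (evict the least recently requested cached element) never evicts a marked element while an unmarked cached element exists, so LRU is an instance of the Marker family of algorithms. -/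
variable {Z : Type*}

/-- The last-request time of element `z` at (i.e. strictly before) time `i`:
`lastReq σ i z = t + 1` for the largest `t < i` with `σ t = z`, and `0` if `z`
was never requested before time `i` (in particular, elements of the initial
cache that were never requested get last-request time `0`). -/
noncomputable def lastReq (σ : ℕ → Z) (i : ℕ) (z : Z) : ℕ :=
  sSup {m | 0 < m ∧ m ≤ i ∧ σ (m - 1) = z}

/-- A run of an arbitrary eviction algorithm on the request sequence `σ` while
maintaining the Marker bookkeeping: `C i` is the cache and `M i` the set of
marked cached elements just before serving request `i`.  Marks are cleared at
each phase start (a new phase starts when the cache is full, all cached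
elements are marked, and a miss occurs); a requested element that is in the
cache is marked; on a miss, if the cache is full an arbitrary cached element is
evicted, and the requested element is inserted and marked. -/
def MarkerRun [DecidableEq Z] (k n : ℕ) (σ : ℕ → Z) (S0 : Finset Z)
    (C M : ℕ → Finset Z) : Prop :=
  C 0 = S0 ∧ M 0 = ∅ ∧ ∀ i < n,
    if σ i ∈ C i then
      C (i + 1) = C i ∧ M (i + 1) = insert (σ i) (M i)
    else
      -- cache miss; clear marks if the cache is full and all its elements are marked
      let M' := if (C i).card = k ∧ M i = C i then (∅ : Finset Z) else M i
      if (C i).card < k then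
        C (i + 1) = insert (σ i) (C i) ∧ M (i + 1) = insert (σ i) M'
      else
        ∃ e ∈ C i, C (i + 1) = insert (σ i) ((C i).erase e) ∧
          M (i + 1) = insert (σ i) (M'.erase e)

theorem lastReq_le (σ : ℕ → Z) (i : ℕ) (z : Z) : lastReq σ i z ≤ i :=
  csSup_le' fun _ hm => hm.2.1

theorem lastReq_succ_self (σ : ℕ → Z) (i : ℕ) : lastReq σ (i + 1) (σ i) = i + 1 :=
  (lastReq_le σ (i + 1) (σ i)).antisymm <|
    le_csSup ⟨i + 1, fun _ hm => hm.2.1⟩ ⟨i.succ_pos, le_rfl, rfl⟩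

theorem lastReq_succ_of_ne {σ : ℕ → Z} {i : ℕ} {z : Z} (h : z ≠ σ i) :
    lastReq σ (i + 1) z = lastReq σ i z := by
  unfold lastReq
  congr 1
  ext m
  refine ⟨fun ⟨h0, hm, hz⟩ => ⟨h0, ?_, hz⟩, fun ⟨h0, hm, hz⟩ => ⟨h0, hm.trans i.le_succ, hz⟩⟩
  refine Nat.le_of_lt_succ (hm.lt_of_ne ?_)
  rintro rfl
  exact h hz.symm

/-- In one step of a Marker run, every surviving old element keeps its mark bit, unless
all marks have been cleared. -/
theorem MarkerRun.step [DecidableEq Z] {k n : ℕ} {σ : ℕ → Z} {S0 : Finset Z}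
    {C M : ℕ → Finset Z} (hrun : MarkerRun k n σ S0 C M) {i : ℕ} (hi : i < n) :
    σ i ∈ M (i + 1) ∧ (∀ z ∈ C (i + 1), z ≠ σ i → z ∈ C i) ∧
      ((∀ z ∈ M (i + 1), z = σ i) ∨
        ∀ z ∈ C (i + 1), z ≠ σ i → (z ∈ M (i + 1) ↔ z ∈ M i)) := by
  have h := hrun.2.2 i hi
  dsimp only at h
  split_ifs at h
  all_goals
    first
    | obtain ⟨e, he, hC, hM⟩ := h
    | obtain ⟨hC, hM⟩ := h
    rw [hC, hM]
    grind

/-- Every marked cached element was requested more recently than every unmarked one. -/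
theorem MarkerRun.lastReq_lt [DecidableEq Z] {k n : ℕ} {σ : ℕ → Z} {S0 : Finset Z}
    {C M : ℕ → Finset Z} (hrun : MarkerRun k n σ S0 C M) {i : ℕ} (hi : i ≤ n) :
    ∀ z ∈ C i, z ∈ M i → ∀ w ∈ C i, w ∉ M i → lastReq σ i w < lastReq σ i z := by
  induction i with
  | zero => simp [hrun.2.1]
  | succ i ih =>
    intro z hz hzM w hw hwM
    obtain ⟨hσ, hC, hM⟩ := hrun.step hi
    have hwσ : w ≠ σ i := fun h => hwM (h ▸ hσ)
    rw [lastReq_succ_of_ne hwσ]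
    by_cases hzσ : z = σ i
    · rw [hzσ, lastReq_succ_self]
      exact Nat.lt_succ_of_le (lastReq_le σ i w)
    · rw [lastReq_succ_of_ne hzσ]
      rcases hM with hM | hM
      · exact absurd (hM z hzM) hzσ
      · exact ih (Nat.le_of_succ_le hi) z (hC z hz hzσ) ((hM z hz hzσ).1 hzM) w (hC w hw hwσ)
          fun h => hwM ((hM w hw hwσ).2 h)

/-- Run any eviction algorithm while maintaining the Marker
bookkeeping.  Then at every point in time, every marked cached element was last
requested strictly more recently than every unmarked cached element.
Consequently, whenever the cache contains at least one unmarked element (in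
particular on any cache miss at such a time), every least recently requested
cached element is unmarked; so the LRU rule (evict a least recently requested
cached element) never evicts a marked element while an unmarked cached element
exists, i.e. LRU is an instance of the Marker family of algorithms. -/
theorem marker_bookkeeping_lru [DecidableEq Z] (k n : ℕ) (hk : 1 ≤ k)
    (S0 : Finset Z) (hS0 : S0.card = k) (σ : ℕ → Z)
    (C M : ℕ → Finset Z) (hrun : MarkerRun k n σ S0 C M) :
    ∀ i ≤ n,
      (∀ z ∈ C i, z ∈ M i → ∀ w ∈ C i, w ∉ M i → lastReq σ i w < lastReq σ i z) ∧
      ((C i \ M i).Nonempty →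
        ∀ z ∈ C i, (∀ w ∈ C i, lastReq σ i z ≤ lastReq σ i w) → z ∉ M i) := by
  intro i hi
  have hlt := hrun.lastReq_lt hi
  refine ⟨hlt, ?_⟩
  rintro ⟨w, hw⟩ z hz hmin hzM
  obtain ⟨hwC, hwM⟩ := Finset.mem_sdiff.1 hw
  exact (hlt z hz hzM w hwC hwM).not_ge (hmin w hwC)
end
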